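/- arXiv:1602.06474 — 6 statements merged into one kernel-verified Lean document; each statement's English description precedes it below -/
import Mathlib

section
/- Let n ≥ 1 and let the group G = (ZMod n) × (ZMod n) act on the permutations of ZMod n by (a,b) · σ = (translation by a) ∘ σ ∘ (translation by b). Then the sum, over the orbits of this action, of 1/(order of the stabilizer of any point of the orbit), taken in ℚ, equals (n−1)!/n. -/
/-- The action of `(ZMod n) × (ZMod n)` (written multiplicatively) on permutations of
`ZMod n`, where `(a, b) • σ = (translation by a) ∘ σ ∘ (translation by b)`. -/
instance translationAction (n : ℕ) :
    MulAction (Multiplicative (ZMod n × ZMod n)) (Equiv.Perm (ZMod n)) where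
  smul g σ := ((Equiv.addLeft g.toAdd.2).trans σ).trans (Equiv.addLeft g.toAdd.1)
  one_smul σ := by
    ext x
    simp [HSMul.hSMul]
  mul_smul g h σ := by
    ext x
    simp [HSMul.hSMul, add_comm, add_left_comm, add_assoc]

/-- The weighted orbit count of a finite group action is `|X| / |G|`. -/
theorem MulAction.finsum_one_div_card_stabilizer (G X : Type*) [Group G] [MulAction G X]
    [Finite G] [Finite X] :
    ∑ᶠ ω : MulAction.orbitRel.Quotient G X,
      (1 : ℚ) / Nat.card (MulAction.stabilizer G (Quotient.out ω)) =
        (Nat.card X : ℚ) / Nat.card G := by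
  have : Finite (MulAction.orbitRel.Quotient G X) := Quotient.finite _
  have := Fintype.ofFinite (MulAction.orbitRel.Quotient G X)
  rw [finsum_eq_sum_of_fintype,
    Nat.card_congr (MulAction.selfEquivSigmaOrbitsQuotientStabilizer G X), Nat.card_sigma,
    Nat.cast_sum, Finset.sum_div]
  refine Finset.sum_congr rfl fun ω _ => ?_
  have h := Subgroup.card_eq_card_quotient_mul_card_subgroup
    (MulAction.stabilizer G (Quotient.out ω))
  have hG : (Nat.card G : ℚ) ≠ 0 := by exact_mod_cast Nat.card_pos.ne'
  have hS : (Nat.card (MulAction.stabilizer G (Quotient.out ω)) : ℚ) ≠ 0 := by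
    exact_mod_cast Nat.card_pos.ne'
  rw [div_eq_div_iff hS hG, one_mul]
  exact_mod_cast h

/-- The weighted count of orbits of the translation action on permutations of `ZMod n`
(each orbit weighted by the reciprocal of the order of the stabilizer of any of its
points) equals `(n-1)!/n`. -/
theorem abelBelyi_weighted_count (n : ℕ) (hn : 1 ≤ n) :
    ∑ᶠ ω : MulAction.orbitRel.Quotient (Multiplicative (ZMod n × ZMod n))
        (Equiv.Perm (ZMod n)),
      (1 : ℚ) / Nat.card (MulAction.stabilizer (Multiplicative (ZMod n × ZMod n))
        (Quotient.out ω)) = (Nat.factorial (n - 1)) / n := by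
  have : NeZero n := ⟨by lia⟩
  have hn0 : (n : ℚ) ≠ 0 := by exact_mod_cast NeZero.ne n
  have : Finite (Multiplicative (ZMod n × ZMod n)) :=
    inferInstanceAs (Finite (ZMod n × ZMod n))
  have hG : Nat.card (Multiplicative (ZMod n × ZMod n)) = n * n := by
    rw [Nat.card_congr Multiplicative.toAdd, Nat.card_prod, Nat.card_zmod]
  rw [MulAction.finsum_one_div_card_stabilizer, hG, Nat.card_perm, Nat.card_zmod,
    ← Nat.mul_factorial_pred (NeZero.ne n)]
  push_cast
  field_simp
end

section
/- For every integer n > 3, one has the identity in ℚ: Σ_{d ∣ n} μ(n/d)·(d−1)(d−2)/6 = φ(n)·ψ(n)/6 − φ(n)/2, where μ is the Möbius function, φ is Euler's totient function, and ψ is the Dedekind psi function ψ(n) = n·∏_{p prime, p ∣ n} (1 + 1/p). -/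
/-- The Dedekind psi function `ψ(n) = n·∏_{p ∣ n, p prime} (1 + 1/p)`, as a rational
number. -/
def dedekindPsi (n : ℕ) : ℚ :=
  n * ∏ p ∈ n.primeFactors, (1 + 1 / (p : ℚ))

open ArithmeticFunction in
/-- The `k`-th Jordan totient as a Dirichlet convolution and as an Euler product. -/
theorem moebius_mul_pow_eq_pmul_prodPrimeFactors (k : ℕ) :
    ((moebius : ArithmeticFunction ℤ) : ArithmeticFunction ℚ) *
        ((pow k : ArithmeticFunction ℕ) : ArithmeticFunction ℚ) =
      ((pow k : ArithmeticFunction ℕ) : ArithmeticFunction ℚ).pmul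
        (prodPrimeFactors fun p => 1 - 1 / (p : ℚ) ^ k) := by
  have hpow : ((pow k : ArithmeticFunction ℕ) : ArithmeticFunction ℚ).IsMultiplicative :=
    isMultiplicative_pow.natCast
  rw [(isMultiplicative_moebius.intCast.mul hpow).eq_iff_eq_on_prime_powers _ _
    (hpow.pmul (IsMultiplicative.prodPrimeFactors _))]
  intro p m hp
  have hp0 : (p : ℚ) ≠ 0 := by exact_mod_cast hp.ne_zero
  have hpn (i : ℕ) : p ^ i ≠ 0 := pow_ne_zero i hp.ne_zero
  rw [mul_apply, Nat.sum_divisorsAntidiagonal fun a b =>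
    ((moebius : ArithmeticFunction ℤ) : ArithmeticFunction ℚ) a *
      ((pow k : ArithmeticFunction ℕ) : ArithmeticFunction ℚ) b, Nat.sum_divisors_prime_pow hp]
  cases m with
  | zero => simp [pow_apply, prodPrimeFactors_apply]
  | succ m =>
    rw [Finset.sum_range_succ', Finset.sum_range_succ', Finset.sum_eq_zero]
    · rw [pmul_apply, prodPrimeFactors_apply (hpn _), Nat.primeFactors_prime_pow m.succ_ne_zero hp,
        Nat.pow_div (by lia) hp.pos]
      simp [pow_apply, moebius_apply_prime hp, hp.ne_zero]
      field_simp
      ring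
    · intro i _
      simp [moebius_apply_prime_pow hp]

/-- Möbius inversion of `d ↦ d ^ k`. -/
theorem sum_divisors_moebius_mul_pow {n : ℕ} (hn : n ≠ 0) (k : ℕ) :
    ∑ d ∈ n.divisors, (ArithmeticFunction.moebius (n / d) : ℚ) * (d : ℚ) ^ k =
      (n : ℚ) ^ k * ∏ p ∈ n.primeFactors, (1 - 1 / (p : ℚ) ^ k) := by
  have h := congrArg (fun f => f n) (moebius_mul_pow_eq_pmul_prodPrimeFactors k)
  simp only [ArithmeticFunction.mul_apply, ArithmeticFunction.pmul_apply,
    ArithmeticFunction.prodPrimeFactors_apply hn] at h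
  rw [Nat.sum_divisorsAntidiagonal' fun a b =>
    ((ArithmeticFunction.moebius : ArithmeticFunction ℤ) : ArithmeticFunction ℚ) a *
      ((ArithmeticFunction.pow k : ArithmeticFunction ℕ) : ArithmeticFunction ℚ) b] at h
  have hpow {d : ℕ} (hd : d ≠ 0) :
      ((ArithmeticFunction.pow k : ArithmeticFunction ℕ) : ArithmeticFunction ℚ) d =
        (d : ℚ) ^ k := by
    simp [ArithmeticFunction.pow_apply, hd]
  rw [hpow hn] at h
  rw [← h]
  refine Finset.sum_congr rfl fun d hd => ?_
  rw [hpow (Nat.pos_of_mem_divisors hd).ne', ArithmeticFunction.intCoe_apply]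

/-- `φ(n)ψ(n)` is the second Jordan totient of `n`. -/
theorem totient_mul_dedekindPsi (n : ℕ) :
    (Nat.totient n : ℚ) * dedekindPsi n =
      (n : ℚ) ^ 2 * ∏ p ∈ n.primeFactors, (1 - 1 / (p : ℚ) ^ 2) := by
  have hprod : ∏ p ∈ n.primeFactors, (1 - 1 / (p : ℚ) ^ 2) =
      (∏ p ∈ n.primeFactors, (1 - (p : ℚ)⁻¹)) * ∏ p ∈ n.primeFactors, (1 + 1 / (p : ℚ)) := by
    rw [← Finset.prod_mul_distrib]
    exact Finset.prod_congr rfl fun p _ => by ring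
  rw [Nat.totient_eq_mul_prod_factors, dedekindPsi, hprod]
  ring

/-- For `n > 3`, `Σ_{d ∣ n} μ(n/d)·(d−1)(d−2)/6 = φ(n)·ψ(n)/6 − φ(n)/2`. -/
theorem moebius_inversion_hexagon (n : ℕ) (hn : 3 < n) :
    ∑ d ∈ n.divisors,
        (ArithmeticFunction.moebius (n / d) : ℚ) * ((d : ℚ) - 1) * ((d : ℚ) - 2) / 6 =
      (Nat.totient n : ℚ) * dedekindPsi n / 6 - (Nat.totient n : ℚ) / 2 := by
  have hn0 : n ≠ 0 := by lia
  have h0 : ∑ d ∈ n.divisors, (ArithmeticFunction.moebius (n / d) : ℚ) * (d : ℚ) ^ 0 = 0 := by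
    rw [sum_divisors_moebius_mul_pow hn0]
    have hne : n.primeFactors.card ≠ 0 := by
      simpa using And.intro hn0 (show n ≠ 1 by lia)
    simp [hne]
  have h1 : ∑ d ∈ n.divisors, (ArithmeticFunction.moebius (n / d) : ℚ) * (d : ℚ) ^ 1 =
      Nat.totient n := by
    rw [sum_divisors_moebius_mul_pow hn0, Nat.totient_eq_mul_prod_factors]
    simp
  have h2 := sum_divisors_moebius_mul_pow hn0 2
  rw [totient_mul_dedekindPsi, ← h2, ← h1, ← sub_zero (_ - _), ← zero_div (-3 : ℚ), ← h0,
    Finset.sum_div, Finset.sum_div, Finset.sum_div, ← Finset.sum_sub_distrib,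
    ← Finset.sum_sub_distrib]
  exact Finset.sum_congr rfl fun d _ => by ring
end

section
/- For every integer n ≥ 2, one has the identity in ℚ: Σ_{k=1}^{n−1} (φ(gcd(n,k))/gcd(n,k))·k·(n−k) = n·φ(n)·ψ(n)/6, where φ is Euler's totient function and ψ is the Dedekind psi function ψ(n) = n·∏_{p prime, p ∣ n} (1 + 1/p). -/
open ArithmeticFunction in
/-- The Euler product of a twisted Möbius sum: `Σ_{d ∣ n} μ(d) f(d) = ∏_{p ∣ n} (1 - f(p))` for
multiplicative `f`. -/
theorem sum_divisors_moebius_mul_eq_prod {R : Type*} [CommRing R] (f : ArithmeticFunction R)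
    (hf : f.IsMultiplicative) {n : ℕ} (hn : n ≠ 0) :
    ∑ d ∈ n.divisors, (moebius d : R) * f d = ∏ p ∈ n.primeFactors, (1 - f p) := by
  rw [← Nat.primeFactors_radical, hf.prodPrimeFactors_one_sub_of_squarefree f
    UniqueFactorizationMonoid.squarefree_radical]
  symm
  apply Finset.sum_subset
    (Nat.divisors_subset_of_dvd hn UniqueFactorizationMonoid.radical_dvd_self)
  intro d hd hd'
  have hsq : ¬ Squarefree d := fun h => hd' <| Nat.mem_divisors.mpr
    ⟨(UniqueFactorizationMonoid.dvd_radical_iff h.isRadical hn).mpr (Nat.dvd_of_mem_divisors hd),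
      UniqueFactorizationMonoid.radical_ne_zero⟩
  simp [moebius_eq_zero_of_not_squarefree hsq]

open ArithmeticFunction in
theorem sum_divisors_moebius_div_pow (k : ℕ) (hk : k ≠ 0) {n : ℕ} (hn : n ≠ 0) :
    ∑ d ∈ n.divisors, (moebius d : ℚ) / (d : ℚ) ^ k =
      ∏ p ∈ n.primeFactors, (1 - 1 / (p : ℚ) ^ k) := by
  let f : ArithmeticFunction ℚ := ⟨fun d => 1 / (d : ℚ) ^ k, by simp [hk]⟩
  have hf : f.IsMultiplicative := by
    refine ⟨by simp [f], fun {a b} _ => ?_⟩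
    simp [f, mul_pow, mul_comm]
  simpa [f, div_eq_mul_inv] using sum_divisors_moebius_mul_eq_prod f hf hn

open ArithmeticFunction in
theorem totient_div_self_eq_sum_moebius {n : ℕ} (hn : n ≠ 0) :
    (Nat.totient n : ℚ) / n = ∑ d ∈ n.divisors, (moebius d : ℚ) / d := by
  have h := sum_divisors_moebius_div_pow 1 one_ne_zero hn
  simp only [pow_one] at h
  have hn' : (n : ℚ) ≠ 0 := Nat.cast_ne_zero.mpr hn
  rw [h, Nat.totient_eq_mul_prod_factors, mul_div_cancel_left₀ _ hn']
  simp

open ArithmeticFunction in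
theorem sum_divisors_moebius_eq_zero {n : ℕ} (hn : n ≠ 1) :
    ∑ d ∈ n.divisors, (moebius d : ℚ) = 0 := by
  rw [← Int.cast_sum, ← coe_mul_zeta_apply, moebius_mul_coe_zeta, one_apply_ne hn, Int.cast_zero]

theorem sum_range_filter_dvd {M : Type*} [AddCommMonoid M] (g : ℕ → M) {d : ℕ} (hd : d ≠ 0)
    (m : ℕ) : ∑ k ∈ Finset.range (d * m) with d ∣ k, g k = ∑ j ∈ Finset.range m, g (d * j) := by
  have hd' := Nat.pos_of_ne_zero hd
  symm
  refine Finset.sum_bij (fun j _ => d * j) ?_ ?_ ?_ (fun _ _ => rfl)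
  · intro j hj
    simpa [hd'] using hj
  · intro a _ b _ h
    exact Nat.eq_of_mul_eq_mul_left hd' h
  · intro k hk
    obtain ⟨hk, j, rfl⟩ := Finset.mem_filter.mp hk
    exact ⟨j, by simpa [hd'] using hk, rfl⟩

theorem sum_range_mul_sub (m : ℕ) (x : ℚ) :
    ∑ j ∈ Finset.range m, (j : ℚ) * (x - j) =
      x * (m * (m - 1) / 2) - m * (m - 1) * (2 * m - 1) / 6 := by
  induction m with
  | zero => simp
  | succ m ih =>
    rw [Finset.sum_range_succ, ih]
    push_cast
    ring

/-- The sum of `k (n - k)` over the multiples `k < n` of a divisor `d` of `n`. -/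
theorem sum_multiples_mul_sub {n d : ℕ} (hn : n ≠ 0) (hd : d ∣ n) :
    ∑ k ∈ Finset.range n with d ∣ k, (k : ℚ) * (n - k) = (n ^ 3 / d - n * d) / 6 := by
  obtain ⟨m, rfl⟩ := hd
  have hd0 : d ≠ 0 := left_ne_zero_of_mul hn
  have hdQ : (d : ℚ) ≠ 0 := Nat.cast_ne_zero.mpr hd0
  rw [sum_range_filter_dvd _ hd0]
  have h : ∀ j ∈ Finset.range m, ((d * j : ℕ) : ℚ) * ((d * m : ℕ) - (d * j : ℕ)) =
      (d : ℚ) ^ 2 * (j * (m - j)) := fun j _ => by push_cast; ring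
  rw [Finset.sum_congr rfl h, ← Finset.mul_sum, sum_range_mul_sub]
  push_cast
  field_simp
  ring

/-- For `n ≥ 2`, `Σ_{k=1}^{n−1} (φ(gcd(n,k))/gcd(n,k))·k·(n−k) = n·φ(n)·ψ(n)/6`. -/
theorem degree_kappa_identity (n : ℕ) (hn : 2 ≤ n) :
    ∑ k ∈ Finset.Ico 1 n,
        (Nat.totient (Nat.gcd n k) : ℚ) / (Nat.gcd n k : ℚ) * (k : ℚ) * ((n : ℚ) - (k : ℚ)) =
      (n : ℚ) * (Nat.totient n : ℚ) * dedekindPsi n / 6 := by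
  have hn0 : n ≠ 0 := by lia
  have hrange : Finset.range n = insert 0 (Finset.Ico 1 n) := by
    ext k
    simp only [Finset.mem_range, Finset.mem_insert, Finset.mem_Ico]
    lia
  calc
    _ = ∑ k ∈ Finset.range n,
        (Nat.totient (Nat.gcd n k) : ℚ) / (Nat.gcd n k : ℚ) * (k : ℚ) * ((n : ℚ) - k) := by
      rw [hrange, Finset.sum_insert (by simp)]
      simp
    _ = ∑ k ∈ Finset.range n, ∑ d ∈ n.divisors,
        if d ∣ k then (ArithmeticFunction.moebius d : ℚ) / d * (k * (n - k)) else 0 := by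
      refine Finset.sum_congr rfl fun k _ => ?_
      have hdiv : (n.gcd k).divisors = n.divisors.filter (· ∣ k) := by
        ext d
        simp [Nat.dvd_gcd_iff, hn0]
      rw [totient_div_self_eq_sum_moebius (Nat.gcd_ne_zero_left hn0), hdiv, mul_assoc,
        Finset.sum_mul, Finset.sum_filter]
    _ = ∑ d ∈ n.divisors, (ArithmeticFunction.moebius d : ℚ) / d * ((n ^ 3 / d - n * d) / 6) := by
      rw [Finset.sum_comm]
      refine Finset.sum_congr rfl fun d hd => ?_
      rw [← Finset.sum_filter, ← Finset.mul_sum,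
        sum_multiples_mul_sub hn0 (Nat.dvd_of_mem_divisors hd)]
    _ = n ^ 3 / 6 * ∑ d ∈ n.divisors, (ArithmeticFunction.moebius d : ℚ) / (d : ℚ) ^ 2 -
        n / 6 * ∑ d ∈ n.divisors, (ArithmeticFunction.moebius d : ℚ) := by
      rw [Finset.mul_sum, Finset.mul_sum, ← Finset.sum_sub_distrib]
      refine Finset.sum_congr rfl fun d hd => ?_
      have hd0 : (d : ℚ) ≠ 0 := Nat.cast_ne_zero.mpr (Nat.pos_of_mem_divisors hd).ne'
      field_simp
    _ = n ^ 3 / 6 * ∏ p ∈ n.primeFactors, ((1 - (p : ℚ)⁻¹) * (1 + 1 / (p : ℚ))) := by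
      rw [sum_divisors_moebius_eq_zero (by lia), sum_divisors_moebius_div_pow 2 two_ne_zero hn0,
        mul_zero, sub_zero]
      congr 1
      refine Finset.prod_congr rfl fun p _ => ?_
      rw [one_div, one_div, ← inv_pow]
      ring
    _ = _ := by
      rw [Finset.prod_mul_distrib, dedekindPsi, Nat.totient_eq_mul_prod_factors]
      ring
end

section
/- Define polynomials R_n, S_n ∈ ℤ[X] by R_0 = −2, R_1 = 1, R_{m+2} = −R_{m+1} − X·R_m and S_0 = 0, S_1 = 1, S_{m+2} = −S_{m+1} − X·S_m. Then for every n ≥ 0, the identity R_n² − 4·Xⁿ = (1 − 4X)·S_n² holds in ℤ[X]. -/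
/-- The polynomials `R_n ∈ ℤ[X]` defined by `R_0 = −2`, `R_1 = 1`,
`R_{m+2} = −R_{m+1} − X·R_m`. -/
noncomputable def R : ℕ → Polynomial ℤ
  | 0 => -2
  | 1 => 1
  | (m + 2) => -R (m + 1) - Polynomial.X * R m

/-- The polynomials `S_n ∈ ℤ[X]` defined by `S_0 = 0`, `S_1 = 1`,
`S_{m+2} = −S_{m+1} − X·S_m`. -/
noncomputable def S : ℕ → Polynomial ℤ
  | 0 => 0
  | 1 => 1
  | (m + 2) => -S (m + 1) - Polynomial.X * S m

theorem R_add_two (n : ℕ) : R (n + 2) = -R (n + 1) - Polynomial.X * R n := by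
  rw [R]

theorem S_add_two (n : ℕ) : S (n + 2) = -S (n + 1) - Polynomial.X * S n := by
  rw [S]

/-- The norm identity at `n` and `n + 1`, together with the mixed identity
`R_n R_{n+1} − (1 − 4X) S_n S_{n+1} = −2Xⁿ` linking consecutive terms. -/
theorem R_S_consecutive_identities (n : ℕ) :
    (R n) ^ 2 - 4 * Polynomial.X ^ n = (1 - 4 * Polynomial.X) * (S n) ^ 2 ∧
    (R (n + 1)) ^ 2 - 4 * Polynomial.X ^ (n + 1) =
      (1 - 4 * Polynomial.X) * (S (n + 1)) ^ 2 ∧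
    R n * R (n + 1) + 2 * Polynomial.X ^ n =
      (1 - 4 * Polynomial.X) * (S n * S (n + 1)) := by
  induction n with
  | zero =>
    simp only [R, S, zero_add]
    refine ⟨?_, ?_, ?_⟩ <;> ring
  | succ n ih =>
    obtain ⟨h₀, h₁, h₂⟩ := ih
    refine ⟨h₁, ?_, ?_⟩
    · rw [R_add_two, S_add_two]
      linear_combination h₁ + 2 * Polynomial.X * h₂ + Polynomial.X ^ 2 * h₀
    · rw [R_add_two, S_add_two]
      linear_combination -h₁ - Polynomial.X * h₂

/-- `R_n² − 4Xⁿ = (1 − 4X)·S_n²` in `ℤ[X]`. -/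
theorem R_sq_sub_four_X_pow (n : ℕ) :
    (R n) ^ 2 - 4 * Polynomial.X ^ n = (1 - 4 * Polynomial.X) * (S n) ^ 2 :=
  (R_S_consecutive_identities n).1
end

section
/- Let k ∈ ℝ and let u₀ ∈ ℝ be such that Q(u₀) > 0 and g(u₀) > 0, where Q(u) = (u² + k·u)² − 4u and g(u) = u·(u+k)² − 2 + (u+k)·√(Q(u)). Then the function F(u) = ln(g(u)) is differentiable at u₀ with derivative F'(u₀) = (3u₀ + k)/√(Q(u₀)). -/
/-- If `Q(u) = (u² + ku)² − 4u` and `g(u) = u(u+k)² − 2 + (u+k)√(Q(u))`, then at any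
point `u₀` with `Q(u₀) > 0` and `g(u₀) > 0`, the function `u ↦ ln(g(u))` is
differentiable with derivative `(3u₀ + k)/√(Q(u₀))`. -/
theorem abel_integral_derivative (k u₀ : ℝ)
    (hQ : (u₀ ^ 2 + k * u₀) ^ 2 - 4 * u₀ > 0)
    (hg : u₀ * (u₀ + k) ^ 2 - 2
        + (u₀ + k) * Real.sqrt ((u₀ ^ 2 + k * u₀) ^ 2 - 4 * u₀) > 0) :
    HasDerivAt
      (fun u : ℝ => Real.log (u * (u + k) ^ 2 - 2
        + (u + k) * Real.sqrt ((u ^ 2 + k * u) ^ 2 - 4 * u)))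
      ((3 * u₀ + k) / Real.sqrt ((u₀ ^ 2 + k * u₀) ^ 2 - 4 * u₀)) u₀ := by
  have hs := Real.sqrt_pos.mpr hQ
  have hsq := Real.sq_sqrt hQ.le
  have hid := hasDerivAt_id' u₀
  have hP := (((hid.pow 2).add (hid.const_mul k)).pow 2).sub (hid.const_mul 4)
  have hw := hid.add_const k
  have hlog := (((hid.mul (hw.pow 2)).sub_const 2).add (hw.mul (hP.sqrt hQ.ne'))).log hg.ne'
  refine hlog.congr_deriv ?_
  simp only [Pi.add_apply, Pi.sub_apply, Pi.mul_apply, Pi.pow_apply]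
  rw [div_eq_div_iff hg.ne' hs.ne']
  set s := Real.sqrt ((u₀ ^ 2 + k * u₀) ^ 2 - 4 * u₀)
  field_simp
  push_cast
  linear_combination 2 * hsq
end

section
/- Let n > 3 be an integer and p ≥ 5 a prime with p ∤ n. Then Σ_{k=1}^{⌊n/p⌋} ((k·p − 3)/2)·(n − k·p) + Σ_{k=1}^{⌊n/(2p)⌋} (k / p^{ν_p(k)})·(n − 2·k·p) ≤ (n−1)(n−2)(n−3)/24, the inequality holding in ℚ, where ν_p(k) denotes the p-adic valuation of k. -/
/-- An instance of the AM-GM inequality for three numbers with sum `3 * n`, one of which may be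
negative. -/
theorem mul_mul_three_mul_sub_le_cube {n a b : ℚ} (hn : 0 ≤ n) (ha : 0 ≤ a) (hb : 0 ≤ b) :
    a * b * (3 * n - a - b) ≤ n ^ 3 := by
  have hab : 0 ≤ a * b := mul_nonneg ha hb
  rcases le_total (3 * n - a - b) 0 with h | h
  · exact (mul_nonpos_of_nonneg_of_nonpos hab h).trans (by positivity)
  · have h₁ := mul_nonneg (sq_nonneg (a - b)) h
    have h₂ : 0 ≤ (2 * n - a - b) ^ 2 * (n + a + b) := by positivity
    linear_combination h₁ / 4 + h₂ / 4

theorem sum_Icc_mul_sub_mul (n q : ℚ) (m : ℕ) :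
    ∑ k ∈ Finset.Icc 1 m, (k : ℚ) * (n - k * q) =
      (m : ℚ) * (m + 1) * (3 * n - 2 * m * q - q) / 6 := by
  induction m with
  | zero => simp
  | succ m ih =>
    rw [Finset.sum_Icc_succ_top (by omega), ih]
    push_cast
    ring

theorem sum_Icc_mul_sub_mul_le {n q : ℚ} (hn : 0 ≤ n) (hq : 0 < q) (m : ℕ) :
    ∑ k ∈ Finset.Icc 1 m, (k : ℚ) * (n - k * q) ≤ n ^ 3 / (6 * q ^ 2) := by
  rw [sum_Icc_mul_sub_mul, le_div_iff₀ (by positivity)]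
  have h := mul_mul_three_mul_sub_le_cube hn (a := m * q) (b := m * q + q) (by positivity)
    (by positivity)
  linear_combination h

/-- A natural number `k ≤ n / q` satisfies `k * q ≤ n`, also after casting to `ℚ`. -/
theorem cast_mul_le_of_mem_Icc_div {n q k : ℕ} (hk : k ∈ Finset.Icc 1 (n / q)) :
    (k : ℚ) * q ≤ n := by
  exact_mod_cast (Nat.mul_le_mul_right q (Finset.mem_Icc.mp hk).2).trans (Nat.div_mul_le_self n q)

theorem sum_Icc_mul_sub_three_div_two_mul_le {n p : ℕ} (hp : 0 < p) :
    ∑ k ∈ Finset.Icc 1 (n / p), ((k : ℚ) * (p : ℚ) - 3) / 2 * ((n : ℚ) - (k : ℚ) * (p : ℚ)) ≤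
      (n : ℚ) ^ 3 / (12 * p) := by
  have hp' : (0 : ℚ) < p := by exact_mod_cast hp
  calc _ ≤ ∑ k ∈ Finset.Icc 1 (n / p), (p : ℚ) / 2 * ((k : ℚ) * (n - k * p)) := by
        refine Finset.sum_le_sum fun k hk => ?_
        linear_combination 3 / 2 * cast_mul_le_of_mem_Icc_div hk
    _ ≤ (p : ℚ) / 2 * ((n : ℚ) ^ 3 / (6 * p ^ 2)) := by
        rw [← Finset.mul_sum]
        gcongr
        exact sum_Icc_mul_sub_mul_le (by positivity) hp' _
    _ = _ := by field_simp; ring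

theorem sum_Icc_div_pow_padicValNat_mul_le {n p : ℕ} (hp : 0 < p) :
    ∑ k ∈ Finset.Icc 1 (n / (2 * p)),
        (k : ℚ) / (p : ℚ) ^ (padicValNat p k) * ((n : ℚ) - 2 * (k : ℚ) * (p : ℚ)) ≤
      (n : ℚ) ^ 3 / (24 * p ^ 2) := by
  have hp' : (1 : ℚ) ≤ p := by exact_mod_cast hp
  calc _ ≤ ∑ k ∈ Finset.Icc 1 (n / (2 * p)), (k : ℚ) * (n - k * (2 * p)) := by
        refine Finset.sum_le_sum fun k hk => ?_
        have h := cast_mul_le_of_mem_Icc_div hk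
        push_cast at h
        rw [show (n : ℚ) - 2 * k * p = n - k * (2 * p) by ring]
        exact mul_le_mul_of_nonneg_right (div_le_self (by positivity) (one_le_pow₀ hp'))
          (sub_nonneg.mpr h)
    _ ≤ (n : ℚ) ^ 3 / (6 * (2 * p) ^ 2) := sum_Icc_mul_sub_mul_le (by positivity) (by positivity) _
    _ = _ := by ring

/-- For `n > 3` and a prime `p ≥ 5` not dividing `n`,
`Σ_{k=1}^{⌊n/p⌋} ((kp−3)/2)(n−kp) + Σ_{k=1}^{⌊n/(2p)⌋} (k/p^{ν_p(k)})(n−2kp)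
  ≤ (n−1)(n−2)(n−3)/24`, where `ν_p` is the `p`-adic valuation. -/
theorem square_count_nonneg (n p : ℕ) (hn : 3 < n) (hp : p.Prime) (hp5 : 5 ≤ p)
    (hpn : ¬ p ∣ n) :
    ∑ k ∈ Finset.Icc 1 (n / p),
        ((k : ℚ) * (p : ℚ) - 3) / 2 * ((n : ℚ) - (k : ℚ) * (p : ℚ))
      + ∑ k ∈ Finset.Icc 1 (n / (2 * p)),
          (k : ℚ) / (p : ℚ) ^ (padicValNat p k) * ((n : ℚ) - 2 * (k : ℚ) * (p : ℚ)) ≤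
      ((n : ℚ) - 1) * ((n : ℚ) - 2) * ((n : ℚ) - 3) / 24 := by
  have hn' : (4 : ℚ) ≤ n := by exact_mod_cast hn
  have hp' : (5 : ℚ) ≤ p := by exact_mod_cast hp5
  rcases lt_or_ge n p with hlt | hle
  · rw [Nat.div_eq_of_lt hlt, Nat.div_eq_of_lt (by omega : n < 2 * p)]
    simp only [Finset.Icc_eq_empty_of_lt zero_lt_one, Finset.sum_empty, add_zero]
    have h₁ : (0 : ℚ) ≤ n - 1 := by linarith
    have h₂ : (0 : ℚ) ≤ n - 2 := by linarith
    have h₃ : (0 : ℚ) ≤ n - 3 := by linarith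
    positivity
  rcases lt_or_ge n 9 with hsmall | hlarge
  · interval_cases n <;> interval_cases p <;> norm_num at *
  · have hn9 : (9 : ℚ) ≤ n := by exact_mod_cast hlarge
    have h₁ : (n : ℚ) ^ 3 / (12 * p) ≤ (n : ℚ) ^ 3 / (12 * 5) := by gcongr
    have h₂ : (n : ℚ) ^ 3 / (24 * p ^ 2) ≤ (n : ℚ) ^ 3 / (24 * 5 ^ 2) := by gcongr
    have h₃ := sum_Icc_mul_sub_three_div_two_mul_le (n := n) hp.pos
    have h₄ := sum_Icc_div_pow_padicValNat_mul_le (n := n) hp.pos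
    have h₅ : (n : ℚ) ^ 3 / (12 * 5) + (n : ℚ) ^ 3 / (24 * 5 ^ 2) ≤
        ((n : ℚ) - 1) * (n - 2) * (n - 3) / 24 := by
      obtain ⟨t, ht⟩ : ∃ t : ℚ, (n : ℚ) = t + 9 := ⟨n - 9, by ring⟩
      have ht0 : 0 ≤ t := by linarith
      rw [ht, ← sub_nonneg]
      ring_nf
      positivity
    linarith
end
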